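/- Let T be the Liverani–Saussol–Vaienti intermittent map with parameter α∈(0,1), with absolutely continuous invariant probability measure. The function f(x) = log|T'(x)| - ∫log|T'|dm cannot be written as f = u - u∘T + λq + μ almost everywhere, where u:[0,1]→ℝ is measurable, q:[0,1]→ℤ is measurable, and λ,μ∈ℝ. -/

import Mathlib

open MeasureTheory Set

/-- The Liverani–Saussol–Vaienti intermittent map with parameter `a ∈ (0,1)`:
`T x = x (1 + 2^a x^a)` for `x ≤ 1/2` and `T x = 2x - 1` for `x > 1/2`. -/
noncomputable def lsv (a : ℝ) (x : ℝ) : ℝ :=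
  if x ≤ 1/2 then x * (1 + (2:ℝ) ^ a * x ^ a) else 2 * x - 1

/-- The derivative of the LSV map: `T'(x) = 1 + 2^a (1+a) x^a` for `x ≤ 1/2`,
`T'(x) = 2` for `x > 1/2`. -/
noncomputable def lsvDeriv (a : ℝ) (x : ℝ) : ℝ :=
  if x ≤ 1/2 then 1 + (2:ℝ) ^ a * (1 + a) * x ^ a else 2

noncomputable section LSVProof

open Filter Topology

/-- number of visits to the right branch -/
def visN (a : ℝ) (n : ℕ) (x : ℝ) : ℕ :=
  ∑ i ∈ Finset.range n, if (lsv a)^[i] x > 1/2 then 1 else 0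

structure Br (a : ℝ) (n : ℕ) (x : ℝ) (h h' : ℝ → ℝ) : Prop where
  pos : ∀ z, 0 < z → 0 < h z
  maps : ∀ z ∈ Ioc (0:ℝ) 1, h z ∈ Ioc (0:ℝ) 1
  inv : ∀ z ∈ Ioc (0:ℝ) 1, (lsv a)^[n] (h z) = z
  base : h ((lsv a)^[n] x) = x
  mono : StrictMonoOn h (Ioi 0)
  deriv : ∀ z, 0 < z → HasDerivAt h (h' z) z
  dpos : ∀ z, 0 < z → 0 < h' z
  dle : ∀ z, 0 < z → h' z ≤ (1/2) ^ (visN a n x)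
  dist : ∀ z w, 0 < z → 0 < w →
    |Real.log (h' z) - Real.log (h' w)| ≤ (1 + a) * |Real.log z - Real.log w|
  logd : ∀ z ∈ Ioc (0:ℝ) 1, Real.log (h' z) =
    - ∑ i ∈ Finset.range n, Real.log (lsvDeriv a ((lsv a)^[i] (h z)))

structure Br1 (a : ℝ) (x : ℝ) (h h' : ℝ → ℝ) : Prop where
  pos : ∀ z, 0 < z → 0 < h z
  maps : ∀ z ∈ Ioc (0:ℝ) 1, h z ∈ Ioc (0:ℝ) 1
  inv : ∀ z ∈ Ioc (0:ℝ) 1, lsv a (h z) = z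
  base : h (lsv a x) = x
  mono : StrictMonoOn h (Ioi 0)
  deriv : ∀ z, 0 < z → HasDerivAt h (h' z) z
  dpos : ∀ z, 0 < z → 0 < h' z
  dle : ∀ z, 0 < z → h' z ≤ (1/2) ^ (if x > 1/2 then 1 else 0)
  dist : ∀ z w, 0 < z → 0 < w →
    (1 + a) * |Real.log (h z) - Real.log (h w)| + |Real.log (h' z) - Real.log (h' w)|
      ≤ (1 + a) * |Real.log z - Real.log w|
  logd : ∀ z ∈ Ioc (0:ℝ) 1, Real.log (h' z) = - Real.log (lsvDeriv a (h z))

/-- left branch extended to the half line -/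
def Lb (a x : ℝ) : ℝ := x * (1 + (2:ℝ) ^ a * x ^ a)

def Lb' (a x : ℝ) : ℝ := 1 + (2:ℝ) ^ a * (1 + a) * x ^ a

lemma two_half (a : ℝ) : (2:ℝ) ^ a * (1/2:ℝ) ^ a = 1 := by
  rw [← Real.mul_rpow (by norm_num) (by norm_num)]; norm_num

lemma Lb_half (a : ℝ) : Lb a (1/2) = 1 := by
  unfold Lb; rw [two_half]; norm_num

lemma Lb_deriv (a : ℝ) {x : ℝ} (hx : 0 < x) : HasDerivAt (Lb a) (Lb' a x) x := by
  have h1 : HasDerivAt (fun y : ℝ => y ^ a) (a * x ^ (a - 1)) x :=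
    Real.hasDerivAt_rpow_const (Or.inl hx.ne')
  have h2 := (hasDerivAt_id x).mul ((h1.const_mul ((2:ℝ)^a)).const_add 1)
  refine h2.congr_deriv ?_
  have : x ^ a = x * x ^ (a-1) := by
    rw [Real.rpow_sub_one hx.ne']; field_simp
  simp only [Lb', id]
  rw [this]; ring

lemma Lb_expand {a : ℝ} (ha : 0 < a) {x y : ℝ} (hx : 0 < x) (hxy : x ≤ y) :
    y - x ≤ Lb a y - Lb a x := by
  have h1 : x ^ a ≤ y ^ a := Real.rpow_le_rpow hx.le hxy ha.le
  have h2 : x * x ^ a ≤ y * y ^ a :=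
    mul_le_mul hxy h1 (Real.rpow_nonneg hx.le _) (hx.le.trans hxy)
  have h3 : (0:ℝ) < 2 ^ a := by positivity
  unfold Lb
  nlinarith [mul_le_mul_of_nonneg_left h2 h3.le]

lemma Lb_strictMono {a : ℝ} (ha : 0 < a) : StrictMonoOn (Lb a) (Ioi 0) := by
  intro x hx y hy hxy
  have := Lb_expand ha hx hxy.le
  linarith

lemma Lb_surj {a : ℝ} (ha : 0 < a) (z : ℝ) (hz : 0 < z) : ∃ x, 0 < x ∧ Lb a x = z := by
  have hc : ContinuousOn (Lb a) (Icc 0 z) := by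
    unfold Lb
    have : Continuous fun x : ℝ => x ^ a := Real.continuous_rpow_const ha.le
    fun_prop
  have h0 : Lb a 0 = 0 := by simp [Lb]
  have h1 : z ≤ Lb a z := by
    unfold Lb
    have : 0 < (2:ℝ)^a * z^a := by positivity
    nlinarith
  obtain ⟨x, hx, hxz⟩ := intermediate_value_Icc hz.le hc (show z ∈ Icc _ _ from ⟨by rw [h0]; exact hz.le, h1⟩)
  refine ⟨x, lt_of_le_of_ne hx.1 ?_, hxz⟩
  rintro rfl
  linarith

lemma lsv_left (a : ℝ) {x : ℝ} (h : x ≤ 1/2) : lsv a x = Lb a x := by simp [lsv, Lb]; grind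
lemma lsv_right (a : ℝ) {x : ℝ} (h : 1/2 < x) : lsv a x = 2 * x - 1 := by
  unfold lsv; rw [if_neg (not_le.2 h)]
lemma lsvD_left (a : ℝ) {x : ℝ} (h : x ≤ 1/2) : lsvDeriv a x = Lb' a x := by
  unfold lsvDeriv Lb'; rw [if_pos h]
lemma lsvD_right (a : ℝ) {x : ℝ} (h : 1/2 < x) : lsvDeriv a x = 2 := by
  unfold lsvDeriv; rw [if_neg (not_le.2 h)]

lemma lsv_maps {a : ℝ} (ha : 0 < a) {x : ℝ} (hx : x ∈ Ioc (0:ℝ) 1) : lsv a x ∈ Ioc (0:ℝ) 1 := by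
  by_cases h : x ≤ 1/2
  · rw [lsv_left a h]
    refine ⟨?_, ?_⟩
    · have := hx.1
      unfold Lb; positivity
    · have := (Lb_strictMono ha).monotoneOn hx.1 (show (1/2:ℝ) ∈ Ioi 0 by norm_num) h
      rwa [Lb_half] at this
  · push Not at h
    rw [lsv_right a h]
    exact ⟨by linarith, by linarith [hx.2]⟩

lemma lsv_iter_maps {a : ℝ} (ha : 0 < a) {x : ℝ} (hx : x ∈ Ioc (0:ℝ) 1) (n : ℕ) :
    (lsv a)^[n] x ∈ Ioc (0:ℝ) 1 := by
  induction n with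
  | zero => exact hx
  | succ n ih => rw [Function.iterate_succ_apply']; exact lsv_maps ha ih

lemma Lb'_pos {a : ℝ} (ha : 0 < a) {x : ℝ} (hx : 0 < x) : 1 < Lb' a x := by
  unfold Lb'
  have : 0 < (2:ℝ) ^ a * (1 + a) * x ^ a := by positivity
  linarith

/-- key monotonicity -/
lemma key_t {a : ℝ} (ha : 0 < a) {t r : ℝ} (ht : 0 < t) (htr : t ≤ r) :
    Real.log (1 + (1+a) * r) - Real.log (1 + (1+a)*t) ≤
      (1 + a) * (Real.log (1 + r) - Real.log (1+t)) := by
  have hm : MonotoneOn (fun t : ℝ => (1 + a) * Real.log (1 + t) - Real.log (1 + (1+a)*t)) (Ici 0) := by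
    have hd : ∀ x : ℝ, 0 ≤ x → HasDerivAt
        (fun t : ℝ => (1 + a) * Real.log (1 + t) - Real.log (1 + (1+a)*t))
        ((1+a) * (1 / (1+x)) - (1+a)*1/(1+(1+a)*x)) x := by
      intro x hx
      have h1 : HasDerivAt (fun t : ℝ => 1 + t) 1 x := (hasDerivAt_id x).const_add 1
      have h2 : HasDerivAt (fun t : ℝ => 1 + (1+a)*t) ((1+a)*1) x :=
        ((hasDerivAt_id x).const_mul (1+a)).const_add 1
      have p1 : 1 + x ≠ 0 := by positivity
      have p2 : 1 + (1+a)*x ≠ 0 := by positivity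
      exact ((h1.log p1).const_mul (1+a)).sub (h2.log p2)
    apply monotoneOn_of_deriv_nonneg (convex_Ici 0)
    · exact fun x hx => (hd x hx).continuousAt.continuousWithinAt
    · intro x hx
      rw [interior_Ici] at hx
      exact (hd x (le_of_lt hx)).differentiableAt.differentiableWithinAt
    · intro x hx
      rw [interior_Ici] at hx
      have hx : 0 < x := hx
      rw [(hd x hx.le).deriv, sub_nonneg, mul_one, div_eq_mul_one_div]
      gcongr
      nlinarith [mul_pos ha hx]
  have := hm (show t ∈ Ici 0 from ht.le) (show r ∈ Ici 0 from (ht.le.trans htr)) htr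
  simp only at this
  linarith

lemma key_left {a : ℝ} (ha : 0 < a) {x y : ℝ} (hx : 0 < x) (hxy : x ≤ y) :
    (1 + a) * |Real.log y - Real.log x| + |Real.log (Lb' a y) - Real.log (Lb' a x)|
      ≤ (1 + a) * |Real.log (Lb a y) - Real.log (Lb a x)| := by
  have hy : 0 < y := hx.trans_le hxy
  have h1 : x ^ a ≤ y ^ a := Real.rpow_le_rpow hx.le hxy ha.le
  have h3 : (0:ℝ) < 2 ^ a := by positivity
  have hxa : 0 < x ^ a := by positivity
  have hya : 0 < y ^ a := by positivity
  have k := key_t ha (t := 2^a * x^a) (r := 2^a*y^a) (by positivity) (by gcongr)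
  have e : ∀ z, Lb' a z = 1 + (1+a) * (2^a * z^a) := by intro z; unfold Lb'; ring
  have hl : ∀ z, 0 < z → Real.log (Lb a z) = Real.log z + Real.log (1 + 2^a * z^a) := by
    intro z hz
    unfold Lb
    rw [Real.log_mul hz.ne' (by positivity)]
  have m1 : Real.log x ≤ Real.log y := Real.log_le_log hx hxy
  have m2 : Real.log (Lb' a x) ≤ Real.log (Lb' a y) := by
    apply Real.log_le_log
    · linarith [Lb'_pos ha hx]
    · unfold Lb'; gcongr
  have m3 : Real.log (1 + 2^a * x^a) ≤ Real.log (1 + 2^a * y^a) := by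
    apply Real.log_le_log
    · positivity
    · gcongr
  rw [hl x hx, hl y hy, abs_of_nonneg (by linarith), abs_of_nonneg (by linarith), abs_of_nonneg (by linarith)]
  rw [e, e]
  linarith

lemma br1_left {a : ℝ} (ha : 0 < a) {x : ℝ} (hx : x ∈ Ioc (0:ℝ) 1) (h : x ≤ 1/2) :
    ∃ h h', Br1 a x h h' := by
  choose! l hl0 hl using Lb_surj ha
  have hmono : StrictMonoOn l (Ioi 0) := by
    intro z hz w hw hzw
    by_contra hc
    push Not at hc
    have := (Lb_strictMono ha).monotoneOn (hl0 w hw) (hl0 z hz) hc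
    rw [hl z hz, hl w hw] at this
    linarith
  have hhalf : ∀ z ∈ Ioc (0:ℝ) 1, l z ≤ 1/2 := by
    intro z hz
    by_contra hc
    push Not at hc
    have := (Lb_strictMono ha) (show (1/2:ℝ) ∈ Ioi 0 by norm_num) (hl0 z hz.1) hc
    rw [Lb_half, hl z hz.1] at this
    linarith [hz.2]
  have hlip : ∀ z w, 0 < z → 0 < w → |l z - l w| ≤ |z - w| := by
    intro z w hz hw
    rcases le_total (l z) (l w) with hc | hc
    · have := Lb_expand ha (hl0 z hz) hc
      rw [hl z hz, hl w hw] at this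
      rw [abs_sub_comm, abs_sub_comm z, abs_of_nonneg (by linarith), abs_of_nonneg (by linarith)]
      exact this
    · have := Lb_expand ha (hl0 w hw) hc
      rw [hl z hz, hl w hw] at this
      rw [abs_of_nonneg (by linarith), abs_of_nonneg (by linarith)]
      exact this
  have hcont : ∀ z, 0 < z → ContinuousAt l z := by
    intro z hz
    rw [ContinuousAt, tendsto_iff_dist_tendsto_zero]
    have h0 : Tendsto (fun w => dist w z) (𝓝 z) (𝓝 0) := by
      rw [← tendsto_iff_dist_tendsto_zero]; exact tendsto_id
    refine squeeze_zero' (Eventually.of_forall fun _ => dist_nonneg) ?_ h0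
    filter_upwards [Ioi_mem_nhds hz] with w hw
    exact hlip w z hw hz
  refine ⟨l, fun z => (Lb' a (l z))⁻¹, ?_, ?_, ?_, ?_, hmono, ?_, ?_, ?_, ?_, ?_⟩
  · exact hl0
  · intro z hz
    exact ⟨hl0 z hz.1, by linarith [hhalf z hz]⟩
  · intro z hz
    rw [lsv_left a (hhalf z hz), hl z hz.1]
  · have hm := lsv_maps ha hx
    apply (Lb_strictMono ha).injOn (hl0 _ hm.1) hx.1
    rw [hl _ hm.1, lsv_left a h]
  · intro z hz
    refine HasDerivAt.of_local_left_inverse (hcont z hz) (Lb_deriv a (hl0 z hz)) ?_ ?_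
    · linarith [Lb'_pos ha (hl0 z hz)]
    · filter_upwards [Ioi_mem_nhds hz] with w hw
      exact hl w hw
  · intro z hz
    have := Lb'_pos ha (hl0 z hz)
    positivity
  · intro z hz
    rw [if_neg (not_lt.2 h), pow_zero]
    exact inv_le_one_of_one_le₀ (Lb'_pos ha (hl0 z hz)).le
  · intro z w hz hw
    simp only [Real.log_inv]
    rcases le_total (l z) (l w) with hc | hc
    · have := key_left ha (hl0 z hz) hc
      rw [hl z hz, hl w hw] at this
      rw [abs_sub_comm (Real.log (l z)), abs_sub_comm (Real.log z)]
      rw [neg_sub_neg]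
      exact this
    · have := key_left ha (hl0 w hw) hc
      rw [hl z hz, hl w hw] at this
      rw [neg_sub_neg, abs_sub_comm (Real.log (Lb' a (l w)))]
      exact this
  · intro z hz
    rw [Real.log_inv, lsvD_left a (hhalf z hz)]

lemma br1_right {a : ℝ} (ha : 0 < a) {x : ℝ} (h : 1/2 < x) :
    ∃ h h', Br1 a x h h' := by
  have key : ∀ z w : ℝ, 0 < z → z ≤ w → 
      |Real.log ((1+w)/2) - Real.log ((1+z)/2)| ≤ |Real.log w - Real.log z| := by
    intro z w hz hzw
    have hw : 0 < w := hz.trans_le hzw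
    have h1 : Real.log ((1+z)/2) ≤ Real.log ((1+w)/2) := Real.log_le_log (by positivity) (by gcongr)
    have h2 : Real.log z ≤ Real.log w := Real.log_le_log hz hzw
    rw [abs_of_nonneg (by linarith), abs_of_nonneg (by linarith),
      ← Real.log_div (by positivity) (by positivity), ← Real.log_div (by positivity) (by positivity)]
    apply Real.log_le_log (by positivity)
    rw [div_le_div_iff₀ (by positivity) (by positivity)]
    nlinarith
  refine ⟨fun z => (1+z)/2, fun _ => 1/2, ?_, ?_, ?_, ?_, ?_, ?_, ?_, ?_, ?_, ?_⟩
  · intro z hz; positivity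
  · rintro z ⟨h1, h2⟩; exact ⟨by positivity, by linarith⟩
  · rintro z ⟨h1, h2⟩
    rw [lsv_right a (by linarith)]; ring
  · rw [lsv_right a h]; ring
  · intro z _ w _ hzw
    simp only; linarith
  · intro z hz
    exact ((hasDerivAt_id z).const_add 1).div_const 2
  · intro z hz; norm_num
  · intro z hz
    rw [if_pos h]; norm_num
  · intro z w hz hw
    simp only [sub_self, abs_zero, add_zero]
    apply mul_le_mul_of_nonneg_left _ (by linarith)
    rcases le_total z w with hc | hc
    · rw [abs_sub_comm, abs_sub_comm (Real.log z)]
      exact key z w hz hc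
    · exact key w z hw hc
  · rintro z ⟨h1, h2⟩
    rw [lsvD_right a (by linarith), ← Real.log_inv]; norm_num

lemma br1_exists {a : ℝ} (ha : 0 < a) {x : ℝ} (hx : x ∈ Ioc (0:ℝ) 1) :
    ∃ h h', Br1 a x h h' := by
  rcases le_or_gt x (1/2) with h | h
  · exact br1_left ha hx h
  · exact br1_right ha h

lemma br_exists {a : ℝ} (ha : 0 < a) {x : ℝ} (hx : x ∈ Ioc (0:ℝ) 1) (n : ℕ) :
    ∃ h h', Br a n x h h' := by
  induction n with
  | zero =>
    refine ⟨fun z => z, fun _ => 1, ?_, ?_, ?_, ?_, ?_, ?_, ?_, ?_, ?_, ?_⟩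
    · exact fun z hz => hz
    · exact fun z hz => hz
    · intro z _; rfl
    · rfl
    · intro z _ w _ hzw; exact hzw
    · intro z _; exact hasDerivAt_id z
    · intro z _; norm_num
    · intro z _; simp [visN]
    · intro z w _ _
      simp only [sub_self, abs_zero]; positivity
    · intro z _; simp
  | succ n ih =>
    obtain ⟨h, h', B⟩ := ih
    obtain ⟨b, b', C⟩ := br1_exists ha (lsv_iter_maps ha hx n)
    refine ⟨fun z => h (b z), fun z => h' (b z) * b' z, ?_, ?_, ?_, ?_, ?_, ?_, ?_, ?_, ?_, ?_⟩
    · exact fun z hz => B.pos _ (C.pos z hz)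
    · exact fun z hz => B.maps _ (C.maps z hz)
    · intro z hz
      rw [Function.iterate_succ_apply', B.inv _ (C.maps z hz), C.inv z hz]
    · rw [Function.iterate_succ_apply', C.base, B.base]
    · intro z hz w hw hzw
      exact B.mono (C.pos z hz) (C.pos w hw) (C.mono hz hw hzw)
    · intro z hz
      exact (B.deriv _ (C.pos z hz)).comp z (C.deriv z hz)
    · intro z hz
      exact mul_pos (B.dpos _ (C.pos z hz)) (C.dpos z hz)
    · intro z hz
      unfold visN
      rw [Finset.sum_range_succ, pow_add]
      exact mul_le_mul (B.dle _ (C.pos z hz)) (C.dle z hz) (C.dpos z hz).le (by positivity)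
    · intro z w hz hw
      have p1 := B.dpos _ (C.pos z hz)
      have p2 := B.dpos _ (C.pos w hw)
      have p3 := C.dpos z hz
      have p4 := C.dpos w hw
      rw [Real.log_mul p1.ne' p3.ne', Real.log_mul p2.ne' p4.ne']
      have d1 := B.dist _ _ (C.pos z hz) (C.pos w hw)
      have d2 := C.dist z w hz hw
      have := abs_add_le (Real.log (h' (b z)) - Real.log (h' (b w))) (Real.log (b' z) - Real.log (b' w))
      rw [add_sub_add_comm]
      linarith
    · intro z hz
      have p1 := B.dpos _ (C.pos z hz.1)
      have p3 := C.dpos z hz.1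
      rw [Real.log_mul p1.ne' p3.ne', Finset.sum_range_succ, B.inv _ (C.maps z hz),
        B.logd _ (C.maps z hz), C.logd z hz]
      ring

lemma exists_visit {a : ℝ} (ha : 0 < a) {x : ℝ} (hx : x ∈ Ioc (0:ℝ) 1) :
    ∃ n, 1/2 < (lsv a)^[n] x := by
  by_contra hc
  push Not at hc
  have h3 : (0:ℝ) < 2 ^ a := by positivity
  have hxp := hx.1
  have hc0 : 0 < (2:ℝ)^a * x^a := by positivity
  have : ∀ n : ℕ, x * (1 + 2^a * x^a)^n ≤ (lsv a)^[n] x := by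
    intro n
    induction n with
    | zero => simp
    | succ n ih =>
      have hp := lsv_iter_maps ha hx n
      have hge : x ≤ (lsv a)^[n] x := by
        refine le_trans ?_ ih
        exact le_mul_of_one_le_right hxp.le (one_le_pow₀ (by linarith))
      rw [Function.iterate_succ_apply', lsv_left a (hc n), pow_succ, ← mul_assoc]
      unfold Lb
      have : x ^ a ≤ ((lsv a)^[n] x) ^ a := Real.rpow_le_rpow hxp.le hge ha.le
      have hp1 := hp.1
      gcongr
  have ht : Tendsto (fun n : ℕ => x * (1 + 2^a * x^a)^n) atTop atTop :=
    (tendsto_pow_atTop_atTop_of_one_lt (by linarith)).const_mul_atTop hxp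
  obtain ⟨n, hn⟩ := (ht.eventually_gt_atTop 1).exists
  linarith [this n, hc n]

lemma visN_tendsto {a : ℝ} (ha : 0 < a) {x : ℝ} (hx : x ∈ Ioc (0:ℝ) 1) :
    Tendsto (fun n => visN a n x) atTop atTop := by
  have hm : Monotone (fun n => visN a n x) := by
    apply monotone_nat_of_le_succ
    intro n
    unfold visN
    rw [Finset.sum_range_succ]
    exact Nat.le_add_right _ _
  apply tendsto_atTop_atTop_of_monotone hm
  intro b
  induction b with
  | zero => exact ⟨0, Nat.zero_le _⟩
  | succ b ih =>
    obtain ⟨n, hn⟩ := ih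
    obtain ⟨k, hk⟩ := exists_visit ha (lsv_iter_maps ha hx n)
    rw [← Function.iterate_add_apply, add_comm] at hk
    refine ⟨n + k + 1, ?_⟩
    have h1 : visN a (n+k+1) x = visN a (n+k) x + 1 := by
      unfold visN
      rw [Finset.sum_range_succ, if_pos hk]
    have h2 := hm (Nat.le_add_right n k)
    simp only at h2
    omega

lemma br_image {a : ℝ} {n : ℕ} {x : ℝ} {h h' : ℝ → ℝ} (B : Br a n x h h') {δ : ℝ}
    (hδ : 0 < δ) (hδ1 : δ < 1) : h '' Icc δ 1 = Icc (h δ) (h 1) := by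
  apply ContinuousOn.image_Icc_of_monotoneOn hδ1.le
  · exact fun z hz => (B.deriv z (hδ.trans_le hz.1)).continuousAt.continuousWithinAt
  · exact (B.mono.mono fun z hz => hδ.trans_le hz.1).monotoneOn

lemma br_lint {a : ℝ} {n : ℕ} {x : ℝ} {h h' : ℝ → ℝ} (B : Br a n x h h') {δ : ℝ}
    (hδ : 0 < δ) (hδ1 : δ < 1) (g : ℝ → ENNReal) :
    ∫⁻ y in Icc (h δ) (h 1), g y = ∫⁻ z in Icc δ 1, ENNReal.ofReal (h' z) * g (h z) := by
  rw [← br_image B hδ hδ1, lintegral_image_eq_lintegral_abs_deriv_mul (f' := h') measurableSet_Icc]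
  · apply setLIntegral_congr_fun measurableSet_Icc
    intro z hz
    simp only
    rw [abs_of_pos (B.dpos z (hδ.trans_le hz.1))]
  · exact fun z hz => (B.deriv z (hδ.trans_le hz.1)).hasDerivWithinAt
  · exact (B.mono.mono fun z hz => hδ.trans_le hz.1).injOn

lemma br_vol_le {a : ℝ} {n : ℕ} {x : ℝ} {h h' : ℝ → ℝ} (B : Br a n x h h') {δ : ℝ}
    (hδ : 0 < δ) (hδ1 : δ < 1) {P : ℝ} (hP : ∀ z ∈ Icc δ 1, h' z ≤ P) :
    volume (Icc (h δ) (h 1)) ≤ ENNReal.ofReal P := by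
  have := br_lint B hδ hδ1 (fun _ => 1)
  simp only [lintegral_const, Measure.restrict_apply, MeasurableSet.univ, univ_inter, one_mul,
    mul_one] at this
  rw [this]
  calc ∫⁻ z in Icc δ 1, ENNReal.ofReal (h' z) ≤ ∫⁻ z in Icc δ 1, ENNReal.ofReal P :=
        setLIntegral_mono' measurableSet_Icc fun z hz => ENNReal.ofReal_le_ofReal (hP z hz)
    _ = ENNReal.ofReal P * volume (Icc δ 1) := by simp
    _ ≤ ENNReal.ofReal P * 1 := by
        gcongr
        rw [Real.volume_Icc]
        exact ENNReal.ofReal_le_one.2 (by linarith)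
    _ = _ := mul_one _

lemma br_zoom {a : ℝ} (ha : 0 < a) {n : ℕ} {x : ℝ} {h h' : ℝ → ℝ} (B : Br a n x h h') {δ : ℝ}
    (hδ : 0 < δ) (hδ1 : δ < 1) (g : ℝ → ENNReal) :
    ∫⁻ z in Icc δ 1, g (h z) ≤ ENNReal.ofReal (Real.exp (2 * ((1 + a) * (- Real.log δ)))) *
      ((∫⁻ y in Icc (h δ) (h 1), g y) / volume (Icc (h δ) (h 1))) := by
  set M := (1 + a) * (- Real.log δ) with hM
  set d := h' 1 with hd
  have hd0 : 0 < d := B.dpos 1 one_pos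
  have hb : ∀ z ∈ Icc δ 1, |Real.log (h' z) - Real.log d| ≤ M := by
    intro z hz
    have hz0 := hδ.trans_le hz.1
    refine (B.dist z 1 hz0 one_pos).trans ?_
    rw [Real.log_one, sub_zero, abs_of_nonpos (Real.log_nonpos hz0.le hz.2)]
    apply mul_le_mul_of_nonneg_left _ (by linarith)
    exact neg_le_neg (Real.log_le_log hδ hz.1)
  have hlo : ∀ z ∈ Icc δ 1, d * Real.exp (-M) ≤ h' z := by
    intro z hz
    have hz0 := B.dpos z (hδ.trans_le hz.1)
    have := (abs_le.1 (hb z hz)).1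
    rw [← Real.log_le_log_iff (by positivity) hz0, Real.log_mul hd0.ne' (Real.exp_pos _).ne', Real.log_exp]
    linarith
  have hhi : ∀ z ∈ Icc δ 1, h' z ≤ d * Real.exp M := by
    intro z hz
    have hz0 := B.dpos z (hδ.trans_le hz.1)
    have := (abs_le.1 (hb z hz)).2
    rw [← Real.log_le_log_iff hz0 (by positivity), Real.log_mul hd0.ne' (Real.exp_pos _).ne', Real.log_exp]
    linarith
  have hA : ENNReal.ofReal (d * Real.exp (-M)) * ∫⁻ z in Icc δ 1, g (h z) ≤
      ∫⁻ y in Icc (h δ) (h 1), g y := by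
    rw [br_lint B hδ hδ1]
    refine (lintegral_const_mul_le _ _).trans ?_
    refine setLIntegral_mono' measurableSet_Icc fun z hz => ?_
    gcongr
    exact hlo z hz
  have hB := br_vol_le B hδ hδ1 hhi
  have hV0 : volume (Icc (h δ) (h 1)) ≠ 0 := by
    rw [Real.volume_Icc]
    have := B.mono (show δ ∈ Ioi 0 from hδ) (show (1:ℝ) ∈ Ioi 0 by norm_num) hδ1
    simpa using this
  have hVt : volume (Icc (h δ) (h 1)) ≠ ⊤ := by
    rw [Real.volume_Icc]; exact ENNReal.ofReal_ne_top
  rw [← mul_div_assoc, ENNReal.le_div_iff_mul_le (Or.inl hV0) (Or.inl hVt)]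
  calc (∫⁻ z in Icc δ 1, g (h z)) * volume (Icc (h δ) (h 1)) 
      ≤ (∫⁻ z in Icc δ 1, g (h z)) * ENNReal.ofReal (d * Real.exp M) := by gcongr
    _ = ENNReal.ofReal (Real.exp (2 * M)) * (ENNReal.ofReal (d * Real.exp (-M)) * ∫⁻ z in Icc δ 1, g (h z)) := by
        rw [← mul_assoc, ← ENNReal.ofReal_mul (by positivity), mul_comm]
        congr 2
        rw [mul_left_comm, ← Real.exp_add]
        congr 2
        ring
    _ ≤ _ := by gcongr

lemma zoom {a : ℝ} (ha : 0 < a) {F : ℝ → ℂ} (hF : LocallyIntegrable F volume) :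
    ∀ᵐ x ∂(volume : Measure ℝ), x ∈ Ioc (0:ℝ) 1 → ∀ δ : ℝ, 0 < δ → δ < 1 →
      (∃ᶠ n in atTop, δ ≤ (lsv a)^[n] x) → ∀ ε : ENNReal, 0 < ε →
      ∃ n h h', Br a n x h h' ∧ ∫⁻ z in Icc δ 1, ‖F (h z) - F x‖ₑ ≤ ε := by
  filter_upwards [(IsUnifLocDoublingMeasure.vitaliFamily (volume : Measure ℝ) 1).ae_tendsto_lintegral_enorm_sub_div hF]
    with x hx hx01 δ hδ hδ1 hfr ε hε
  choose h h' B using fun n => br_exists ha hx01 n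
  set l : Filter ℕ := atTop ⊓ 𝓟 {n | δ ≤ (lsv a)^[n] x} with hl
  have : l.NeBot := Filter.frequently_mem_iff_neBot.1 hfr
  have hlt : ∀ n, h n δ < h n 1 := fun n =>
    (B n).mono (show δ ∈ Ioi 0 from hδ) (show (1:ℝ) ∈ Ioi 0 by norm_num) hδ1
  have hlim0 : Tendsto (fun n => ((1:ℝ)/2) ^ visN a n x) atTop (𝓝 0) :=
    (tendsto_pow_atTop_nhds_zero_of_lt_one (by norm_num) (by norm_num)).comp (visN_tendsto ha hx01)
  have hle : ∀ n, (h n 1 - h n δ)/2 ≤ ((1:ℝ)/2) ^ visN a n x := by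
    intro n
    have := br_vol_le (B n) hδ hδ1 (fun z hz => (B n).dle z (hδ.trans_le hz.1))
    rw [Real.volume_Icc, ENNReal.ofReal_le_ofReal_iff (by positivity)] at this
    linarith [hlt n]
  have hr : Tendsto (fun n => (h n 1 - h n δ)/2) l (𝓝[>] 0) := by
    rw [tendsto_nhdsWithin_iff]
    constructor
    · refine Tendsto.mono_left ?_ inf_le_left
      exact squeeze_zero (fun n => by linarith [hlt n]) hle hlim0
    · exact Eventually.of_forall fun n => by simpa using hlt n
  have hmem : ∀ᶠ n in l, x ∈ Metric.closedBall ((h n δ + h n 1)/2) (1 * ((h n 1 - h n δ)/2)) := by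
    have : ∀ᶠ n in l, δ ≤ (lsv a)^[n] x := by
      rw [hl, eventually_inf_principal]
      exact Eventually.of_forall fun n hn => hn
    filter_upwards [this] with n hn
    rw [one_mul, ← Real.Icc_eq_closedBall, ← br_image (B n) hδ hδ1]
    exact ⟨_, ⟨hn, (lsv_iter_maps ha hx01 n).2⟩, (B n).base⟩
  have hT := hx.comp (IsUnifLocDoublingMeasure.tendsto_closedBall_filterAt volume _ _ hr hmem)
  have hT2 := ENNReal.Tendsto.const_mul (a := ENNReal.ofReal (Real.exp (2 * ((1 + a) * (- Real.log δ))))) hT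
    (Or.inr ENNReal.ofReal_ne_top)
  rw [mul_zero] at hT2
  obtain ⟨n, hn⟩ := (hT2.eventually_le_const hε).exists
  refine ⟨n, h n, h' n, B n, ?_⟩
  refine (br_zoom ha (B n) hδ hδ1 (fun y => ‖F y - F x‖ₑ)).trans ?_
  simp only [Function.comp_apply, ← Real.Icc_eq_closedBall] at hn
  exact hn

lemma lsv_measurable (a : ℝ) : Measurable (lsv a) := by
  unfold lsv
  refine Measurable.ite measurableSet_Iic ?_ ?_
  · fun_prop
  · fun_prop

lemma lsvDeriv_measurable (a : ℝ) : Measurable (lsvDeriv a) := by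
  unfold lsvDeriv
  refine Measurable.ite measurableSet_Iic ?_ ?_
  · fun_prop
  · fun_prop

lemma frequently_half {a : ℝ} (ha : 0 < a) {x : ℝ} (hx : x ∈ Ioc (0:ℝ) 1) {δ : ℝ} (hδ : δ ≤ 1/2) :
    ∃ᶠ n in atTop, δ ≤ (lsv a)^[n] x := by
  rw [frequently_atTop]
  intro N
  obtain ⟨k, hk⟩ := exists_visit ha (lsv_iter_maps ha hx N)
  rw [← Function.iterate_add_apply] at hk
  exact ⟨k + N, Nat.le_add_left _ _, by linarith⟩

lemma locInt {G : Set ℝ} (hG : MeasurableSet G) (hG1 : G ⊆ Ioc 0 1) {ψ : ℝ → ℂ}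
    (hψ : Measurable ψ) (hn : ∀ x, ‖ψ x‖ = 1) : LocallyIntegrable (G.indicator ψ) volume := by
  apply Integrable.locallyIntegrable
  rw [integrable_indicator_iff hG]
  refine Measure.integrableOn_of_bounded (M := 1) ?_ hψ.aestronglyMeasurable ?_
  · exact ((measure_mono hG1).trans_lt (by simp)).ne
  · exact Eventually.of_forall fun x => (hn x).le

lemma full_of_inv {a : ℝ} (ha : 0 < a) {G : Set ℝ} (hG : MeasurableSet G) (hG1 : G ⊆ Ioc 0 1)
    (hT : MapsTo (lsv a) G G) (hv : volume G ≠ 0) : volume (Ioc 0 1 \ G) = 0 := by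
  obtain ⟨x, hxG, hx⟩ := ((frequently_ae_mem_iff.2 hv).and_eventually
    (zoom ha (locInt hG hG1 (ψ := fun _ => 1) measurable_const (by simp)))).exists
  have key : ∀ δ : ℝ, 0 < δ → δ ≤ 1/2 → volume (Icc δ 1 \ G) = 0 := by
    intro δ hδ hδ2
    by_contra hne
    have hpos : 0 < volume (Icc δ 1 \ G) := pos_iff_ne_zero.2 hne
    have hlt : volume (Icc δ 1 \ G) ≠ ⊤ := ((measure_mono sdiff_subset).trans_lt (by simp)).ne
    obtain ⟨n, h, h', B, hle⟩ := hx (hG1 hxG) δ hδ (by linarith) (frequently_half ha (hG1 hxG) hδ2)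
      (volume (Icc δ 1 \ G) / 2) (ENNReal.half_pos hne)
    have h2 : volume (Icc δ 1 \ G) ≤ ∫⁻ z in Icc δ 1, ‖G.indicator (fun _ => (1:ℂ)) (h z) -
        G.indicator (fun _ => (1:ℂ)) x‖ₑ := by
      calc volume (Icc δ 1 \ G) = ∫⁻ z in Icc δ 1, (Gᶜ).indicator (fun _ => (1:ENNReal)) z := by
            rw [lintegral_indicator hG.compl, lintegral_const, one_mul,
              Measure.restrict_apply MeasurableSet.univ, univ_inter,
              Measure.restrict_apply hG.compl, sdiff_eq, inter_comm]
        _ ≤ _ := by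
            refine setLIntegral_mono' measurableSet_Icc fun z hz => ?_
            by_cases hzG : z ∈ G
            · rw [indicator_of_notMem (by simpa using hzG)]
              exact zero_le
            · have : h z ∉ G := by
                intro hh
                apply hzG
                have := hT.iterate n hh
                rwa [B.inv z ⟨hδ.trans_le hz.1, hz.2⟩] at this
              rw [indicator_of_mem (by simpa using hzG), indicator_of_notMem this,
                indicator_of_mem hxG]
              simp
    exact absurd (h2.trans hle) (not_le.2 (ENNReal.half_lt_self hne hlt))
  have hU : Ioc 0 1 \ G ⊆ ⋃ k : ℕ, Icc (1 / ((k:ℝ) + 2)) 1 \ G := by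
    rintro z ⟨hz, hzG⟩
    obtain ⟨k, hk⟩ := exists_nat_one_div_lt hz.1
    refine mem_iUnion.2 ⟨k, ⟨le_trans ?_ hk.le, hz.2⟩, hzG⟩
    gcongr
    norm_num
  refine measure_mono_null hU (measure_iUnion_null fun k => key _ (by positivity) ?_)
  gcongr
  linarith [(Nat.cast_nonneg k : (0:ℝ) ≤ k)]

lemma near_one {a : ℝ} (N : ℕ) : ∀ δ : ℝ, 0 ≤ δ → δ < 1 → ∃ δ' : ℝ, 0 ≤ δ' ∧ δ' < 1 ∧
    ∀ y ∈ Ioc δ' 1, (lsv a)^[N] y ∈ Ioc δ 1 := by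
  induction N with
  | zero => intro δ h0 h1; exact ⟨δ, h0, h1, fun y hy => hy⟩
  | succ N ih =>
    intro δ h0 h1
    obtain ⟨d, hd0, hd1, hd⟩ := ih δ h0 h1
    refine ⟨(1 + d)/2, by linarith, by linarith, fun y hy => ?_⟩
    rw [Function.iterate_succ_apply]
    apply hd
    rw [lsv_right a (by linarith [hy.1])]
    exact ⟨by linarith [hy.1], by linarith [hy.2]⟩

lemma recur {a : ℝ} (ha : 0 < a) {δ : ℝ} (hδ : 0 < δ) (hδ1 : δ < 1) :
    ∀ᵐ x ∂(volume : Measure ℝ), x ∈ Ioc (0:ℝ) 1 → ∃ᶠ n in atTop, δ ≤ (lsv a)^[n] x := by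
  have key : ∀ N : ℕ, volume {x | x ∈ Ioc (0:ℝ) 1 ∧ ∀ n, N ≤ n → (lsv a)^[n] x < δ} = 0 := by
    intro N
    by_contra hne
    have hm : MeasurableSet {x | x ∈ Ioc (0:ℝ) 1 ∧ ∀ n, N ≤ n → (lsv a)^[n] x < δ} := by
      have : {x | x ∈ Ioc (0:ℝ) 1 ∧ ∀ n, N ≤ n → (lsv a)^[n] x < δ} =
        Ioc (0:ℝ) 1 ∩ ⋂ n, ⋂ (_ : N ≤ n), (lsv a)^[n] ⁻¹' (Iio δ) := by
        ext x; simp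
      rw [this]
      refine measurableSet_Ioc.inter (MeasurableSet.iInter fun n => MeasurableSet.iInter fun _ => ?_)
      exact ((lsv_measurable a).iterate n) measurableSet_Iio
    have := full_of_inv ha hm (fun x hx => hx.1) (fun x hx => ⟨lsv_maps ha hx.1, fun n hn => by
      rw [← Function.iterate_succ_apply]; exact hx.2 (n+1) (by omega)⟩) hne
    obtain ⟨d, hd0, hd1, hd⟩ := near_one (a := a) N δ hδ.le hδ1
    have hsub : Ioc d 1 ⊆ Ioc 0 1 \ {x | x ∈ Ioc (0:ℝ) 1 ∧ ∀ n, N ≤ n → (lsv a)^[n] x < δ} := by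
      intro y hy
      refine ⟨⟨by linarith [hy.1], hy.2⟩, fun h => ?_⟩
      have h1 := h.2 N le_rfl
      have h2 := (hd y hy).1
      linarith
    have h0 := measure_mono_null hsub this
    rw [Real.volume_Ioc, ENNReal.ofReal_eq_zero] at h0
    linarith
  have hall : ∀ᵐ x ∂(volume : Measure ℝ), ∀ N : ℕ, ¬ (x ∈ Ioc (0:ℝ) 1 ∧ ∀ n, N ≤ n → (lsv a)^[n] x < δ) := by
    rw [ae_all_iff]
    intro N
    rw [ae_iff]
    simpa only [not_not] using key N
  filter_upwards [hall] with x hx hx1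
  rw [frequently_atTop]
  intro N
  by_contra hc
  push Not at hc
  exact hx N ⟨hx1, hc⟩

/-- iterating the cocycle identity -/
lemma cocycle_iter {a s : ℝ} {θ : ℂ} {ψ : ℝ → ℂ} {G : Set ℝ} (hT : MapsTo (lsv a) G G)
    (hid : ∀ x ∈ G, ψ x = θ * Complex.exp (Complex.I * (s * Real.log (lsvDeriv a x) : ℝ)) * ψ (lsv a x))
    (n : ℕ) : ∀ x ∈ G, ψ x = θ ^ n * Complex.exp (Complex.I *
      (s * ∑ i ∈ Finset.range n, Real.log (lsvDeriv a ((lsv a)^[i] x)) : ℝ)) * ψ ((lsv a)^[n] x) := by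
  induction n with
  | zero => intro x _; simp
  | succ n ih =>
    intro x hx
    rw [ih x hx, hid _ (hT.iterate n hx), ← Function.iterate_succ_apply' (lsv a),
      Finset.sum_range_succ, mul_add, Complex.ofReal_add, mul_add Complex.I, Complex.exp_add, pow_succ]
    ring

lemma norm_exp_I (t : ℝ) : ‖Complex.exp (Complex.I * (t:ℝ))‖ = 1 := by
  rw [mul_comm]; exact Complex.norm_exp_ofReal_mul_I t

lemma near_const {a s : ℝ} (ha : 0 < a) {θ : ℂ} (hθ : ‖θ‖ = 1) {ψ : ℝ → ℂ} (hψ : Measurable ψ)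
    (hn : ∀ x, ‖ψ x‖ = 1) {G : Set ℝ} (hG : MeasurableSet G) (hG1 : G ⊆ Ioc 0 1)
    (hT : MapsTo (lsv a) G G) (hv : volume G ≠ 0)
    (hid : ∀ x ∈ G, ψ x = θ * Complex.exp (Complex.I * (s * Real.log (lsvDeriv a x) : ℝ)) * ψ (lsv a x))
    {δ : ℝ} (hδ : 0 < δ) (hδ1 : δ < 1) {η : ℝ} (hη : 0 < η) :
    ∃ c : ℂ, ∫⁻ z in Icc δ 1, ‖ψ z - c‖ₑ ≤
      ENNReal.ofReal ((η + |s| * ((1 + a) * (- Real.log δ))) * (1 - δ)) := by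
  obtain ⟨x, ⟨hxG, hx⟩, hrec⟩ := (((frequently_ae_mem_iff.2 hv).and_eventually
    (zoom ha (locInt hG hG1 hψ hn))).and_eventually (recur ha hδ hδ1)).exists
  have hε : 0 < ENNReal.ofReal (η * (1 - δ) / 2) := by
    rw [ENNReal.ofReal_pos]
    have : 0 < 1 - δ := by linarith
    positivity
  obtain ⟨n, h, h', B, hle⟩ := hx (hG1 hxG) δ hδ hδ1 (hrec (hG1 hxG)) _ hε
  have hθ0 : θ ≠ 0 := by rintro rfl; simp at hθ
  set M := |s| * ((1 + a) * (- Real.log δ)) with hM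
  have hM0 : 0 ≤ M := by
    have := Real.log_neg hδ hδ1
    have : 0 ≤ - Real.log δ := by linarith
    positivity
  set c := ψ x * (θ ^ n)⁻¹ * Complex.exp (Complex.I * (s * Real.log (h' 1) : ℝ)) with hc
  refine ⟨c, ?_⟩
  have hcn : ‖c‖ = 1 := by
    rw [hc, norm_mul, norm_mul, norm_exp_I, hn, norm_inv, norm_pow, hθ]; simp
  have hpt : ∀ z ∈ Icc δ 1, ‖ψ z - c‖ ≤ 2 * ‖G.indicator ψ (h z) - G.indicator ψ x‖ + M := by
    intro z hz
    have hz01 : z ∈ Ioc (0:ℝ) 1 := ⟨hδ.trans_le hz.1, hz.2⟩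
    rw [indicator_of_mem hxG]
    by_cases hhG : h z ∈ G
    · rw [indicator_of_mem hhG]
      have e1 := cocycle_iter hT hid n (h z) hhG
      have e2 := B.logd z hz01
      rw [B.inv z hz01, show ∑ i ∈ Finset.range n, Real.log (lsvDeriv a ((lsv a)^[i] (h z))) =
        - Real.log (h' z) by linarith] at e1
      have hd : |s * (Real.log (h' 1) - Real.log (h' z))| ≤ M := by
        rw [abs_mul, hM]
        refine mul_le_mul_of_nonneg_left ?_ (abs_nonneg s)
        refine (B.dist 1 z one_pos hz01.1).trans ?_
        refine mul_le_mul_of_nonneg_left ?_ (by linarith)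
        rw [Real.log_one, zero_sub, abs_neg, abs_of_nonpos (Real.log_nonpos hz01.1.le hz.2)]
        exact neg_le_neg (Real.log_le_log hδ hz.1)
      set E := Complex.exp (Complex.I * (s * (- Real.log (h' z)) : ℝ)) with hE
      have hEn : ‖E‖ = 1 := norm_exp_I _
      have e3 : θ ^ n * E * (ψ z - c) = (ψ (h z) - ψ x) + ψ x * (1 - Complex.exp (Complex.I *
          (s * (Real.log (h' 1) - Real.log (h' z)) : ℝ))) := by
        have : Complex.exp (Complex.I * (s * (Real.log (h' 1) - Real.log (h' z)) : ℝ)) = 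
            Complex.exp (Complex.I * (s * Real.log (h' 1) : ℝ)) * E := by
          rw [hE, ← Complex.exp_add]
          congr 1
          push_cast
          ring
        rw [this, e1, hc]
        have hp : θ ^ n ≠ 0 := pow_ne_zero _ hθ0
        field_simp
        ring
      have e4 : ‖ψ z - c‖ = ‖θ ^ n * E * (ψ z - c)‖ := by
        rw [norm_mul, norm_mul, hEn, norm_pow, hθ]; simp
      have e5 : ‖1 - Complex.exp (Complex.I *
          (s * (Real.log (h' 1) - Real.log (h' z)) : ℝ))‖ ≤ M := by
        rw [norm_sub_rev]
        refine (Real.norm_exp_I_mul_ofReal_sub_one_le).trans ?_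
        rw [Real.norm_eq_abs]
        exact hd
      rw [e4, e3]
      refine (norm_add_le _ _).trans ?_
      rw [norm_mul, hn, one_mul]
      linarith [norm_nonneg (ψ (h z) - ψ x)]
    · rw [indicator_of_notMem hhG, zero_sub, norm_neg, hn]
      refine (norm_sub_le _ _).trans ?_
      rw [hn, hcn]
      linarith
  have hδp : 0 < 1 - δ := by linarith
  calc ∫⁻ z in Icc δ 1, ‖ψ z - c‖ₑ 
      ≤ ∫⁻ z in Icc δ 1, (2 * ‖G.indicator ψ (h z) - G.indicator ψ x‖ₑ + ENNReal.ofReal M) := by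
        refine setLIntegral_mono' measurableSet_Icc fun z hz => ?_
        have := ENNReal.ofReal_le_ofReal (hpt z hz)
        rw [ENNReal.ofReal_add (by positivity) hM0, ENNReal.ofReal_mul (by norm_num)] at this
        simpa only [ofReal_norm, ENNReal.ofReal_ofNat] using this
    _ = 2 * (∫⁻ z in Icc δ 1, ‖G.indicator ψ (h z) - G.indicator ψ x‖ₑ) + ENNReal.ofReal M * ENNReal.ofReal (1 - δ) := by
        rw [lintegral_add_right _ measurable_const, lintegral_const_mul' _ _ (by norm_num)]
        simp
    _ ≤ 2 * ENNReal.ofReal (η * (1 - δ) / 2) + ENNReal.ofReal M * ENNReal.ofReal (1 - δ) := by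
        gcongr
    _ = _ := by
        rw [← ENNReal.ofReal_mul hM0, show (2:ENNReal) = ENNReal.ofReal 2 by simp,
          ← ENNReal.ofReal_mul (by norm_num), ← ENNReal.ofReal_add (by positivity) (by positivity)]
        congr 1
        ring

lemma scale {s : ℝ} {a : ℝ} {θ : ℂ} (hθ : ‖θ‖ = 1) {ψ : ℝ → ℂ} {G : Set ℝ}
    (hful : ∀ᵐ y ∂(volume : Measure ℝ), y ∈ Ioc (0:ℝ) 1 → y ∈ G)
    (hid : ∀ x ∈ G, ψ x = θ * Complex.exp (Complex.I * (s * Real.log (lsvDeriv a x) : ℝ)) * ψ (lsv a x))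
    {δ : ℝ} (hδ : 0 ≤ δ) (hδ1 : δ < 1) {ρ : ℝ} {c : ℂ}
    (h : ∫⁻ z in Icc ((1+δ)/2) 1, ‖ψ z - c‖ₑ ≤ ENNReal.ofReal (ρ * (1 - (1+δ)/2))) :
    ∃ c' : ℂ, ∫⁻ z in Icc δ 1, ‖ψ z - c'‖ₑ ≤ ENNReal.ofReal (ρ * (1 - δ)) := by
  set κ := θ * Complex.exp (Complex.I * (s * Real.log 2 : ℝ)) with hκ
  have hκn : ‖κ‖ = 1 := by rw [hκ, norm_mul, norm_exp_I, hθ, one_mul]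
  have hκ0 : κ ≠ 0 := by intro h0; rw [h0] at hκn; simp at hκn
  refine ⟨κ⁻¹ * c, ?_⟩
  have him : (fun z : ℝ => (1+z)/2) '' Icc δ 1 = Icc ((1+δ)/2) 1 := by
    have := ContinuousOn.image_Icc_of_monotoneOn (f := fun z : ℝ => (1+z)/2) hδ1.le
      (by fun_prop) (fun z _ w _ hzw => by simp only; linarith)
    rw [this]; norm_num
  have hcv := lintegral_image_eq_lintegral_abs_deriv_mul (s := Icc δ 1) (f := fun z : ℝ => (1+z)/2)
    (f' := fun _ => 1/2) measurableSet_Icc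
    (fun z _ => (((hasDerivAt_id z).const_add 1).div_const 2).hasDerivWithinAt)
    (fun z _ w _ hzw => by simp only at hzw; linarith) (fun y => ‖ψ (2*y-1) - κ⁻¹ * c‖ₑ)
  rw [him] at hcv
  have e1 : ∫⁻ z in Icc ((1+δ)/2) 1, ‖ψ z - c‖ₑ = ∫⁻ y in Icc ((1+δ)/2) 1, ‖ψ (2*y-1) - κ⁻¹ * c‖ₑ := by
    apply setLIntegral_congr_fun_ae measurableSet_Icc
    have hne : ∀ᵐ y ∂(volume : Measure ℝ), y ≠ 1/2 := compl_mem_ae_iff.2 (measure_singleton _)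
    filter_upwards [hful, hne] with y hy hy2 hyI
    have h1 : 1/2 < y := lt_of_le_of_ne (by linarith [hyI.1]) (Ne.symm hy2)
    have := hid y (hy ⟨by linarith, hyI.2⟩)
    rw [lsvD_right a h1, lsv_right a h1, ← hκ] at this
    rw [this, show κ * ψ (2*y-1) - c = κ * (ψ (2*y-1) - κ⁻¹ * c) by field_simp, enorm_mul,
      ← ofReal_norm κ, hκn]
    simp
  rw [e1, hcv, lintegral_const_mul' _ _ ENNReal.ofReal_ne_top] at h
  have h2 : (2:ENNReal) * (ENNReal.ofReal |1/2| * ∫⁻ z in Icc δ 1, ‖ψ (2*((1+z)/2)-1) - κ⁻¹ * c‖ₑ)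
      ≤ 2 * ENNReal.ofReal (ρ * (1 - (1+δ)/2)) := by gcongr
  rw [← mul_assoc, show (2:ENNReal) = ENNReal.ofReal 2 by simp, ← ENNReal.ofReal_mul (by norm_num),
    ← ENNReal.ofReal_mul (by norm_num)] at h2
  have e3 : (2:ℝ) * |1/2| = 1 := by norm_num
  rw [e3, ENNReal.ofReal_one, one_mul] at h2
  have e4 : (2:ℝ) * (ρ * (1 - (1+δ)/2)) = ρ * (1 - δ) := by ring
  rw [e4] at h2
  convert h2 using 5
  ring_nf

lemma scale_iter {s : ℝ} {a : ℝ} {θ : ℂ} (hθ : ‖θ‖ = 1) {ψ : ℝ → ℂ} {G : Set ℝ}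
    (hful : ∀ᵐ y ∂(volume : Measure ℝ), y ∈ Ioc (0:ℝ) 1 → y ∈ G)
    (hid : ∀ x ∈ G, ψ x = θ * Complex.exp (Complex.I * (s * Real.log (lsvDeriv a x) : ℝ)) * ψ (lsv a x))
    {ρ : ℝ} (k : ℕ) (h : ∃ c : ℂ, ∫⁻ z in Icc (1 - (1/2:ℝ)^k) 1, ‖ψ z - c‖ₑ ≤
      ENNReal.ofReal (ρ * (1 - (1 - (1/2:ℝ)^k)))) :
    ∃ c : ℂ, ∫⁻ z in Icc 0 1, ‖ψ z - c‖ₑ ≤ ENNReal.ofReal ρ := by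
  induction k with
  | zero => simpa using h
  | succ k ih =>
    apply ih
    obtain ⟨c, hc⟩ := h
    have e : 1 - (1/2:ℝ)^(k+1) = (1 + (1 - (1/2:ℝ)^k))/2 := by rw [pow_succ]; ring
    rw [e] at hc
    have h1 : (1/2:ℝ)^k ≤ 1 := pow_le_one₀ (by norm_num) (by norm_num)
    have h2 : 0 < (1/2:ℝ)^k := by positivity
    exact scale hθ hful hid (by linarith) (by linarith) hc

lemma core {a s : ℝ} (ha : 0 < a) (hs : s ≠ 0) {θ : ℂ} (hθ : ‖θ‖ = 1) {ψ : ℝ → ℂ} (hψ : Measurable ψ)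
    (hn : ∀ x, ‖ψ x‖ = 1) {G : Set ℝ} (hG : MeasurableSet G) (hG1 : G ⊆ Ioc 0 1)
    (hT : MapsTo (lsv a) G G) (hv : volume G ≠ 0)
    (hid : ∀ x ∈ G, ψ x = θ * Complex.exp (Complex.I * (s * Real.log (lsvDeriv a x) : ℝ)) * ψ (lsv a x)) :
    False := by
  have hful : ∀ᵐ y ∂(volume : Measure ℝ), y ∈ Ioc (0:ℝ) 1 → y ∈ G := by
    have := full_of_inv ha hG hG1 hT hv
    rw [ae_iff]
    convert this using 2
    ext y; simp [and_assoc]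
  have hconst : ∀ η : ℝ, 0 < η → ∃ c : ℂ, ∫⁻ z in Icc 0 1, ‖ψ z - c‖ₑ ≤ ENNReal.ofReal (η + η) := by
    intro η hη
    have hlim : Tendsto (fun k : ℕ => |s| * ((1 + a) * (- Real.log (1 - (1/2:ℝ)^k)))) atTop (𝓝 0) := by
      have h1 : Tendsto (fun k : ℕ => 1 - (1/2:ℝ)^k) atTop (𝓝 (1 - 0)) :=
        (tendsto_pow_atTop_nhds_zero_of_lt_one (by norm_num) (by norm_num)).const_sub 1
      rw [sub_zero] at h1
      have h2 := (((h1.log one_ne_zero).neg).const_mul (1+a)).const_mul |s|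
      simpa using h2
    obtain ⟨k, hk, hk1⟩ := ((hlim.eventually_le_const hη).and (eventually_ge_atTop 1)).exists
    have hp : (1/2:ℝ)^k ≤ 1/2 := by
      calc (1/2:ℝ)^k ≤ (1/2:ℝ)^1 := pow_le_pow_of_le_one (by norm_num) (by norm_num) hk1
        _ = 1/2 := pow_one _
    have hp0 : 0 < (1/2:ℝ)^k := by positivity
    obtain ⟨c, hc⟩ := near_const ha hθ hψ hn hG hG1 hT hv hid (δ := 1 - (1/2:ℝ)^k) (by linarith)
      (by linarith) hη
    refine scale_iter hθ hful hid k ⟨c, hc.trans (ENNReal.ofReal_le_ofReal ?_)⟩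
    exact mul_le_mul_of_nonneg_right (by linarith) (by linarith)
  set Φ : ℝ → ℂ := fun x => θ * Complex.exp (Complex.I * (s * Real.log (Lb' a x) : ℝ)) with hΦ
  have hΦn : ∀ x, ‖Φ x‖ = 1 := fun x => by
    simp only [hΦ]; rw [norm_mul, norm_exp_I, hθ, one_mul]
  have hΦm : Measurable Φ := by
    simp only [hΦ, Lb']
    fun_prop
  have hzero : ∫⁻ x in Ioc 0 (1/2), ‖1 - Φ x‖ₑ = 0 := by
    have hb : ∀ η : ℝ, 0 < η → ∫⁻ x in Ioc 0 (1/2), ‖1 - Φ x‖ₑ ≤ ENNReal.ofReal (4 * η) := by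
      intro η hη
      obtain ⟨c, hc⟩ := hconst η hη
      have hpt : ∀ᵐ x ∂(volume : Measure ℝ), x ∈ Ioc (0:ℝ) (1/2) →
          ‖1 - Φ x‖ₑ ≤ ‖ψ x - c‖ₑ + ENNReal.ofReal |Lb' a x| * ‖ψ (Lb a x) - c‖ₑ := by
        filter_upwards [hful] with x hx hxI
        have h1 := hid x (hx ⟨hxI.1, by linarith [hxI.2]⟩)
        rw [lsvD_left a hxI.2, lsv_left a hxI.2] at h1
        have h1' : ψ x = Φ x * ψ (Lb a x) := h1
        have h2 : ‖1 - Φ x‖ ≤ ‖ψ x - c‖ + |Lb' a x| * ‖ψ (Lb a x) - c‖ := by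
          have e : ‖1 - Φ x‖ = ‖(ψ (Lb a x) - c) - (ψ x - c)‖ := by
            rw [sub_sub_sub_cancel_right, h1', ← one_sub_mul, norm_mul, hn, mul_one]
          have hL := Lb'_pos ha hxI.1
          rw [e, abs_of_pos (by linarith)]
          refine (norm_sub_le _ _).trans ?_
          nlinarith [norm_nonneg (ψ (Lb a x) - c)]
        have h3 := ENNReal.ofReal_le_ofReal h2
        rw [ENNReal.ofReal_add (by positivity) (by positivity), ENNReal.ofReal_mul (abs_nonneg _)] at h3
        simpa only [ofReal_norm] using h3
      have hcv := lintegral_image_eq_lintegral_abs_deriv_mul (s := Ioc 0 (1/2)) (f := Lb a)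
        (f' := Lb' a) measurableSet_Ioc
        (fun z hz => (Lb_deriv a hz.1).hasDerivWithinAt)
        ((Lb_strictMono ha).mono fun z hz => hz.1).injOn (fun y => ‖ψ y - c‖ₑ)
      have him : Lb a '' Ioc 0 (1/2) ⊆ Icc 0 1 := by
        rintro _ ⟨x, hx, rfl⟩
        have := lsv_maps ha (x := x) ⟨hx.1, by linarith [hx.2]⟩
        rw [lsv_left a hx.2] at this
        exact ⟨this.1.le, this.2⟩
      calc ∫⁻ x in Ioc 0 (1/2), ‖1 - Φ x‖ₑ 
          ≤ ∫⁻ x in Ioc 0 (1/2), (‖ψ x - c‖ₑ + ENNReal.ofReal |Lb' a x| * ‖ψ (Lb a x) - c‖ₑ) :=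
            lintegral_mono_ae ((ae_restrict_iff' measurableSet_Ioc).2 hpt)
        _ = (∫⁻ x in Ioc 0 (1/2), ‖ψ x - c‖ₑ) + ∫⁻ x in Lb a '' Ioc 0 (1/2), ‖ψ x - c‖ₑ := by
            rw [hcv, lintegral_add_left (by fun_prop)]
        _ ≤ (∫⁻ x in Icc 0 1, ‖ψ x - c‖ₑ) + ∫⁻ x in Icc 0 1, ‖ψ x - c‖ₑ := by
            refine add_le_add (lintegral_mono_set fun x hx => ?_) (lintegral_mono_set him)
            exact ⟨hx.1.le, by linarith [hx.2]⟩
        _ ≤ ENNReal.ofReal (η + η) + ENNReal.ofReal (η + η) := add_le_add hc hc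
        _ = _ := by
            rw [← ENNReal.ofReal_add (by positivity) (by positivity)]
            congr 1; ring
    refine le_antisymm (ENNReal.le_of_forall_pos_le_add fun ε hε _ => ?_) zero_le
    have := hb (ε/4) (by positivity)
    rw [zero_add]
    refine this.trans (le_of_eq ?_)
    rw [show 4 * ((ε:ℝ)/4) = ε by ring, ENNReal.ofReal_coe_nnreal]
  have hae : Φ =ᵐ[volume.restrict (Ioo 0 (1/2))] fun _ => 1 := by
    have := (lintegral_eq_zero_iff (by fun_prop)).1 hzero
    have h2 := ae_restrict_of_ae_restrict_of_subset Ioo_subset_Ioc_self this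
    filter_upwards [h2] with x hx
    have : 1 - Φ x = 0 := by simpa using hx
    exact (sub_eq_zero.1 this).symm
  have hder : ∀ x : ℝ, 0 < x → ∃ d : ℝ, d ≠ 0 ∧
      HasDerivAt Φ (θ * (Complex.exp (Complex.I * (s * Real.log (Lb' a x) : ℝ)) * (Complex.I * (d : ℝ)))) x := by
    intro x hx
    have h1 : HasDerivAt (fun y : ℝ => y ^ a) (a * x ^ (a - 1)) x :=
      Real.hasDerivAt_rpow_const (Or.inl hx.ne')
    have h2 : HasDerivAt (Lb' a) (2 ^ a * (1 + a) * (a * x ^ (a-1))) x :=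
      (h1.const_mul ((2:ℝ)^a * (1 + a))).const_add 1
    have h3 := (h2.log (by linarith [Lb'_pos ha hx])).const_mul s
    have hL := Lb'_pos ha hx
    refine ⟨_, ?_, ((h3.ofReal_comp.const_mul Complex.I).cexp).const_mul θ⟩
    refine mul_ne_zero hs (ne_of_gt ?_)
    positivity
  have heq : EqOn Φ (fun _ => 1) (Ioo 0 (1/2)) := by
    refine Measure.eqOn_open_of_ae_eq hae isOpen_Ioo ?_ continuousOn_const
    intro x hx
    obtain ⟨d, _, hd⟩ := hder x hx.1
    exact hd.continuousAt.continuousWithinAt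
  obtain ⟨d, hd0, hd⟩ := hder (1/4) (by norm_num)
  have hev : Φ =ᶠ[𝓝 (1/4)] fun _ => 1 := heq.eventuallyEq_of_mem (Ioo_mem_nhds (by norm_num) (by norm_num))
  have h0 := hd.unique ((hasDerivAt_const (1/4:ℝ) (1:ℂ)).congr_of_eventuallyEq hev)
  have hθ0 : θ ≠ 0 := by rintro rfl; simp at hθ
  have := mul_ne_zero hθ0 (mul_ne_zero (Complex.exp_ne_zero (Complex.I * (s * Real.log (Lb' a (1/4)) : ℝ)))
    (mul_ne_zero Complex.I_ne_zero (Complex.ofReal_ne_zero.2 hd0)))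
  exact this h0

end LSVProof

/-- Aperiodicity: `f = log |T'| - ∫ log |T'| dm` cannot be written as
`u - u ∘ T + λ q + μ` a.e. with `u` real measurable, `q` integer valued and `λ, μ ∈ ℝ`. -/
theorem lsv_log_deriv_aperiodic
    (a : ℝ) (ha : 0 < a) (ha1 : a < 1)
    (m : Measure ℝ) [IsProbabilityMeasure m]
    (habs : m ≪ volume.restrict (Icc (0:ℝ) 1))
    (hpres : MeasurePreserving (lsv a) m m) :
    ¬ ∃ (u : ℝ → ℝ) (q : ℝ → ℤ) (lam mu : ℝ), Measurable u ∧ Measurable q ∧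
      ∀ᵐ x ∂m,
        Real.log |lsvDeriv a x| - ∫ y, Real.log |lsvDeriv a y| ∂m
          = u x - u (lsv a x) + lam * (q x : ℝ) + mu := by
  rintro ⟨u, q, lam, mu, hu, hq, hae⟩
  set C := ∫ y, Real.log |lsvDeriv a y| ∂m with hC
  obtain ⟨s, hs, hsl⟩ : ∃ s : ℝ, s ≠ 0 ∧ ∀ k : ℤ, Complex.exp (Complex.I * (s * (lam * k) : ℝ)) = 1 := by
    by_cases hl : lam = 0
    · exact ⟨1, one_ne_zero, fun k => by simp [hl]⟩
    · refine ⟨2 * Real.pi / lam, div_ne_zero (by positivity) hl, fun k => ?_⟩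
      rw [Complex.exp_eq_one_iff]
      refine ⟨k, ?_⟩
      rw [show 2 * Real.pi / lam * (lam * k) = k * (2 * Real.pi) by field_simp]
      push_cast
      ring
  set θ : ℂ := Complex.exp (Complex.I * (- s * (C + mu) : ℝ)) with hθ
  set ψ : ℝ → ℂ := fun x => Complex.exp (Complex.I * (s * u x : ℝ)) with hψ
  have hψm : Measurable ψ := by simp only [hψ]; fun_prop
  have hlm := lsv_measurable a
  have hldm := lsvDeriv_measurable a
  set P : Set ℝ := {x | ψ x = θ * Complex.exp (Complex.I * (s * Real.log (lsvDeriv a x) : ℝ)) * ψ (lsv a x)} with hP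
  have hPm : MeasurableSet P := by
    apply measurableSet_eq_fun hψm
    have := hψm.comp hlm
    fun_prop
  have hPae : ∀ᵐ x ∂m, x ∈ P := by
    filter_upwards [hae] with x hx
    rw [Real.log_abs] at hx
    have hux : u x = - (C + mu) + Real.log (lsvDeriv a x) + u (lsv a x) - lam * (q x : ℝ) := by linarith
    have key : ψ x * Complex.exp (Complex.I * (s * (lam * (q x)) : ℝ)) = 
      θ * Complex.exp (Complex.I * (s * Real.log (lsvDeriv a x) : ℝ)) * ψ (lsv a x) := by
      simp only [hψ, hθ]
      rw [← Complex.exp_add, ← Complex.exp_add, ← Complex.exp_add, hux]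
      congr 1
      push_cast
      ring
    rw [hsl, mul_one] at key
    exact key
  set G : Set ℝ := Ioc 0 1 ∩ ⋂ n : ℕ, (lsv a)^[n] ⁻¹' P with hG
  have hGm : MeasurableSet G :=
    measurableSet_Ioc.inter (MeasurableSet.iInter fun n => (hlm.iterate n) hPm)
  have hvm : m ≪ volume := habs.trans Measure.restrict_le_self.absolutelyContinuous
  have hI : ∀ᵐ x ∂m, x ∈ Ioc (0:ℝ) 1 := by
    have h1 : ∀ᵐ x ∂m, x ∈ Icc (0:ℝ) 1 := habs.ae_le (ae_restrict_mem measurableSet_Icc)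
    have h2 : ∀ᵐ x ∂m, x ≠ 0 := hvm.ae_le (compl_mem_ae_iff.2 (measure_singleton _))
    filter_upwards [h1, h2] with x hx hx0
    exact ⟨lt_of_le_of_ne hx.1 (Ne.symm hx0), hx.2⟩
  have hGae : ∀ᵐ x ∂m, x ∈ G := by
    have h3 : ∀ᵐ x ∂m, ∀ n : ℕ, (lsv a)^[n] x ∈ P := by
      rw [ae_all_iff]
      intro n
      exact (hpres.iterate n).quasiMeasurePreserving.ae hPae
    filter_upwards [hI, h3] with x hx hx3
    exact ⟨hx, mem_iInter.2 hx3⟩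
  have hv : volume G ≠ 0 := by
    intro h0
    have h1 := hvm h0
    have h2 := (prob_compl_eq_zero_iff hGm).1 (mem_ae_iff.1 hGae)
    rw [h1] at h2
    exact zero_ne_one h2
  refine core ha hs (norm_exp_I _) hψm (fun x => norm_exp_I _) hGm inter_subset_left ?_ hv ?_
    (θ := θ)
  · rintro x ⟨hx, hx2⟩
    refine ⟨lsv_maps ha hx, mem_iInter.2 fun n => ?_⟩
    have := mem_iInter.1 hx2 (n+1)
    rwa [mem_preimage, Function.iterate_succ_apply] at this
  · rintro x ⟨hx, hx2⟩
    exact mem_iInter.1 hx2 0
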